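/- arXiv:1911.00044 — 5 statements merged into one kernel-verified Lean document; each statement's English description precedes it below -/
import Mathlib

section
/- For every k ∈ [1,n−1] and every string z of length k+1 over Σ, the number of occurrences of z as a substring of Z_k(S) equals the number of rotations of S that have z as a prefix. -/
noncomputable section
open scoped Classical

variable {α : Type*} [LinearOrder α]

/-- The `i`-th rotation (0-indexed) of the string `S`. -/
def rot (S : List α) (i : ℕ) : List α := S.drop i ++ S.take i

/-- `Z_k(S)`: the string `S` with its length-`k` prefix appended. -/
def zk (S : List α) (k : ℕ) : List α := S ++ S.take k

/-- `y` is a `k`-mer of `S`: a length-`k` substring of `Z_k(S)`. -/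
def IsKmer (S : List α) (k : ℕ) (y : List α) : Prop :=
  y.length = k ∧ y <:+: zk S k

/-- The finite set of `k`-mers of `S`. -/
def kmersF (S : List α) (k : ℕ) : Finset (List α) :=
  ((List.range S.length).map (fun i => ((zk S k).drop i).take k)).toFinset

/-- The number of rotations of `S` having `y` as a prefix. -/
def rotCount (S y : List α) : ℕ :=
  (Finset.filter (fun i => y <+: rot S i) (Finset.range S.length)).card

/-- `y` is a prefix of some rotation of `S`. -/
def IsRotPrefix (S y : List α) : Prop := ∃ i < S.length, y <+: rot S i

/-- The number of occurrences of `z` as a substring of `w` (counted by start positions). -/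
def occCount (z w : List α) : ℕ :=
  (Finset.filter (fun i => z <+: w.drop i) (Finset.range w.length)).card

/-- The multiplicity of the edge `(x, y)` in the order-`k` de Bruijn graph of `S`. -/
def edgeMult (S : List α) (k : ℕ) (x y : List α) : ℕ :=
  (Finset.filter
    (fun i => x <+: (zk S k).drop i ∧ y <+: (zk S k).drop (i + 1))
    (Finset.range S.length)).card

/-- `c` is a Weiner link of `y` (for `|y| < n` this says `c·y` is a prefix of a rotation,
and for `|y| = n` that `c·y[1..n-1]` is; note `y.take (n-1) = y` when `|y| ≤ n - 1`). -/
def IsWeinerLink (S y : List α) (c : α) : Prop :=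
  IsRotPrefix S (c :: y.take (S.length - 1))

/-- `y` has a unique Weiner link. -/
def HasUniqueWeinerLink (S y : List α) : Prop := ∃! c, IsWeinerLink S y c

/-- The weight `w_k(y)`. -/
def wWeight (S : List α) (k : ℕ) (y : List α) : ℕ :=
  if ∃ c, (∀ d, IsWeinerLink S y d ↔ d = c) ∧
      ∀ i < S.length, (c :: y.take (k - 1)) <+: rot S i → (c :: y) <+: rot S i
  then 1 else rotCount S y

/-- The edge `(x,y)` of the order-`k` de Bruijn graph is fusible. -/
def FusibleEdge (S : List α) (k : ℕ) (x y : List α) : Prop :=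
  1 ≤ edgeMult S k x y ∧
  (∀ y', 1 ≤ edgeMult S k x y' → y' = y) ∧
  (∀ x', 1 ≤ edgeMult S k x' y → x' = x)

/-- The multiplicity of `(x,y)` in the edge-reduced de Bruijn graph. -/
def redMult (S : List α) (k : ℕ) (x y : List α) : ℕ :=
  if FusibleEdge S k x y then 1 else edgeMult S k x y

/-- The total edge multiplicity `m_k` of the edge-reduced de Bruijn graph. -/
def mRed (S : List α) (k : ℕ) : ℕ :=
  ∑ p ∈ kmersF S k ×ˢ kmersF S k, redMult S k p.1 p.2

/-- The rotations of `S` in increasing lexicographic order. -/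
def sortedRots (S : List α) : List (List α) :=
  List.insertionSort (· ≤ ·) ((List.range S.length).map (rot S))

/-- `R_i` (0-indexed): the `i`-th rotation of `S` in lexicographic order. -/
def Ro (S : List α) (i : ℕ) : List α := (sortedRots S).getD i []

/-- The Burrows–Wheeler transform: `L[i]` is the last character of `R_i`. -/
def bwtL [Inhabited α] (S : List α) (i : ℕ) : α := (Ro S i).getLast!

/-- The LF-mapping (0-indexed): sends `i` to the `j` with `R_j` the rotation obtained
from `R_i` by moving its last character to the front. -/
def lf (S : List α) (i : ℕ) : ℕ :=
  (List.range S.length).findIdx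
    (fun j => decide (Ro S j = (Ro S i).rotate ((Ro S i).length - 1)))

/-- The inverse LF-mapping (0-indexed). -/
def lfInv (S : List α) (i : ℕ) : ℕ :=
  (List.range S.length).findIdx (fun j => decide (Ro S j = (Ro S i).rotate 1))

/-- `LF^x` for an integer `x` (negative `x` iterates the inverse). -/
def lfPow (S : List α) (x : ℤ) (i : ℕ) : ℕ :=
  if 0 ≤ x then (lf S)^[x.toNat] i else (lfInv S)^[(-x).toNat] i

/-- `⟨w, [i,j]⟩` is a prefix interval of the BWT of `S`. -/
def PrefixIntervalP [Inhabited α] (S : List α) (w i j : ℕ) : Prop :=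
  i ≤ j ∧ j < S.length ∧
  ∀ x : ℤ, -1 ≤ x → x < (w : ℤ) →
    ∀ y, i ≤ y → y ≤ j → bwtL S (lfPow S x y) = bwtL S (lfPow S x i)

/-- `(p 0, …, p (w-1))` is a fusible path in the order-`k` de Bruijn graph of `S`. -/
def FusiblePath (S : List α) (k w : ℕ) (p : ℕ → List α) : Prop :=
  1 ≤ w ∧ (∀ t < w, IsKmer S k (p t)) ∧
  (∀ s < w, ∀ t < w, p s = p t → s = t) ∧
  ∀ t, t + 1 < w → FusibleEdge S k (p t) (p (t + 1))

/-- A maximal fusible path: one that is not a proper consecutive subsequence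
of a longer fusible path. -/
def MaximalFusiblePath (S : List α) (k w : ℕ) (p : ℕ → List α) : Prop :=
  FusiblePath S k w p ∧
  ¬ ∃ (w' : ℕ) (p' : ℕ → List α) (off : ℕ),
      FusiblePath S k w' p' ∧ w < w' ∧ off + w ≤ w' ∧ ∀ t < w, p t = p' (t + off)

/-- A window of length `k + 1 ≤ |S|` starting at `i < |S|` reads the same in `Z_k(S)` and in the
`i`-th rotation of `S`. -/
theorem take_drop_zk_eq_take_rot {β : Type*} (S : List β) {k i : ℕ}
    (hk : k + 1 ≤ S.length) (hi : i < S.length) :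
    ((zk S k).drop i).take (k + 1) = (rot S i).take (k + 1) := by
  unfold zk rot
  rw [List.drop_append_of_le_length hi.le, List.take_append, List.take_append, List.take_take,
    List.take_take, List.length_drop]
  congr 2
  omega

/-- for every `k ∈ [1,n-1]` and every string `z` of length `k+1`, the number of
occurrences of `z` as a substring of `Z_k(S)` equals the number of rotations of `S` having
`z` as a prefix. -/
theorem occurrences_eq_rotations_with_prefix
    (S : List α) (dollar : α)
    (hn : 2 ≤ S.length)
    (hlast : S.getLast? = some dollar)
    (hmin : ∀ c : α, c ≠ dollar → dollar < c)
    (honce : ∀ i, i < S.length - 1 → S.getD i dollar ≠ dollar) :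
    ∀ k, 1 ≤ k → k + 1 ≤ S.length →
      ∀ z : List α, z.length = k + 1 → occCount z (zk S k) = rotCount S z := by
  intro k _ hk z hz
  unfold occCount rotCount
  congr 1
  ext i
  simp only [Finset.mem_filter, Finset.mem_range]
  constructor
  · rintro ⟨_, h⟩
    have hi : i < S.length := by
      have := h.length_le
      simp only [zk, List.length_drop, List.length_append, List.length_take] at this
      omega
    refine ⟨hi, ?_⟩
    rwa [List.prefix_iff_eq_take, hz, take_drop_zk_eq_take_rot S hk hi, ← hz,
      ← List.prefix_iff_eq_take] at h
  · rintro ⟨hi, h⟩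
    refine ⟨by simp only [zk, List.length_append]; omega, ?_⟩
    rwa [List.prefix_iff_eq_take, hz, take_drop_zk_eq_take_rot S hk hi, ← hz,
      ← List.prefix_iff_eq_take]
end
end

section
/- Let k ∈ [1,n−1], let x and y be k-mers of S, let m ≥ 1, and set c := x[1]. Then the edge (x,y) has multiplicity m in G_k(S) if and only if x = c·y[1..k−1], the string c·y is a prefix of some rotation of S, and m equals the number of rotations of S that have y as a prefix and whose last character is c. -/
noncomputable section
open scoped Classical

variable {α : Type*} [LinearOrder α]

/-- `y` occurs at position `i` of the infinite periodic extension of `S`. -/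
def OccursCyclicallyAt (S y : List α) (i : ℕ) : Prop :=
  ∀ t < y.length, y[t]? = S[(i + t) % S.length]?

theorem prefix_iff_forall_getElem? {β : Type*} (y l : List β) :
    y <+: l ↔ ∀ t < y.length, y[t]? = l[t]? := by
  rw [List.prefix_iff_getElem?]
  refine forall₂_congr fun t ht => ?_
  rw [List.getElem?_eq_getElem ht, eq_comm]

theorem rot_getElem? {β : Type*} (S : List β) {i t : ℕ} (hi : i ≤ S.length) (ht : t < S.length) :
    (rot S i)[t]? = S[(i + t) % S.length]? := by
  rw [rot, ← List.rotate_eq_drop_append_take hi, List.getElem?_rotate ht, Nat.add_comm]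

theorem rot_getLast? {β : Type*} (S : List β) {i : ℕ} (hi : i < S.length) :
    (rot S i).getLast? = S[(i + (S.length - 1)) % S.length]? := by
  have hlen : (rot S i).length = S.length := by
    simp only [rot, List.length_append, List.length_drop, List.length_take]; omega
  rw [List.getLast?_eq_getElem?, hlen, rot_getElem? S hi.le (by omega)]

theorem zk_getElem? {β : Type*} (S : List β) {k j : ℕ} (hk : k ≤ S.length) (hj : j < S.length + k) :
    (zk S k)[j]? = S[j % S.length]? := by
  rw [zk, List.getElem?_append]
  split_ifs with h
  · rw [Nat.mod_eq_of_lt h]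
  · rw [List.getElem?_take_of_lt (by omega), Nat.mod_eq_sub_mod (by omega),
      Nat.mod_eq_of_lt (by omega)]

theorem prefix_rot_iff {β : Type*} (S y : List β) {i : ℕ} (hi : i ≤ S.length)
    (hy : y.length ≤ S.length) :
    y <+: rot S i ↔ OccursCyclicallyAt S y i := by
  rw [prefix_iff_forall_getElem?]
  refine forall₂_congr fun t ht => ?_
  rw [rot_getElem? S hi (by omega)]

theorem prefix_drop_zk_iff {β : Type*} (S y : List β) {k i : ℕ} (hk : k ≤ S.length)
    (hi : i + y.length ≤ S.length + k) :
    y <+: (zk S k).drop i ↔ OccursCyclicallyAt S y i := by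
  rw [prefix_iff_forall_getElem?]
  refine forall₂_congr fun t ht => ?_
  rw [List.getElem?_drop, zk_getElem? S hk (by omega)]

theorem occursCyclicallyAt_cons {β : Type*} (S y : List β) (c : β) (i : ℕ) :
    OccursCyclicallyAt S (c :: y) i ↔
      S[i % S.length]? = some c ∧ OccursCyclicallyAt S y (i + 1) := by
  simp only [OccursCyclicallyAt, List.length_cons, Nat.forall_lt_succ_left,
    List.getElem?_cons_zero, List.getElem?_cons_succ, Nat.add_zero, eq_comm (a := some c),
    Nat.add_assoc, Nat.add_comm 1]

theorem occursCyclicallyAt_mod {β : Type*} (S y : List β) (i : ℕ) :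
    OccursCyclicallyAt S y (i % S.length) ↔ OccursCyclicallyAt S y i := by
  simp only [OccursCyclicallyAt, Nat.mod_add_mod]

theorem OccursCyclicallyAt.iff_eq_take {β : Type*} {S x y : List β} {i : ℕ}
    (hy : OccursCyclicallyAt S y i) (hxy : x.length ≤ y.length) :
    OccursCyclicallyAt S x i ↔ x = y.take x.length := by
  rw [← List.prefix_iff_eq_take, prefix_iff_forall_getElem?]
  refine forall₂_congr fun t ht => ?_
  rw [hy t (by omega)]

/-- The edge multiplicity counts the cyclic occurrences of `c·y`. -/
theorem edgeMult_cons (S x y : List α) (c : α) (hk : y.length ≤ S.length)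
    (hxy : x.length + 1 = y.length) :
    edgeMult S y.length (c :: x) y =
      if x = y.take x.length then
        ((Finset.range S.length).filter fun i => OccursCyclicallyAt S (c :: y) i).card
      else 0 := by
  have key : ∀ i ∈ Finset.range S.length,
      ((c :: x) <+: (zk S y.length).drop i ∧ y <+: (zk S y.length).drop (i + 1) ↔
        OccursCyclicallyAt S (c :: y) i ∧ x = y.take x.length) := by
    intro i hi
    rw [Finset.mem_range] at hi
    rw [prefix_drop_zk_iff S _ hk (by simp only [List.length_cons]; omega),
      prefix_drop_zk_iff S y hk (by omega), occursCyclicallyAt_cons, occursCyclicallyAt_cons]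
    constructor
    · rintro ⟨⟨hc, hx⟩, hy⟩
      exact ⟨⟨hc, hy⟩, (hy.iff_eq_take (by omega)).1 hx⟩
    · rintro ⟨⟨hc, hy⟩, hx⟩
      exact ⟨⟨hc, (hy.iff_eq_take (by omega)).2 hx⟩, hy⟩
  rw [edgeMult, Finset.filter_congr key]
  split_ifs with h
  · simp only [h.symm, and_true]
  · simp only [h, and_false, Finset.filter_false, Finset.card_empty]

/-- Moving the last character of a rotation to its front matches the rotations that start
with `y` and end with `c` to the cyclic occurrences of `c·y`. -/
theorem card_prefix_rot_getLast? (S y : List α) (c : α) (hy : y.length ≤ S.length) :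
    ((Finset.range S.length).filter
      fun i => y <+: rot S i ∧ (rot S i).getLast? = some c).card =
      ((Finset.range S.length).filter fun i => OccursCyclicallyAt S (c :: y) i).card := by
  have shift : ∀ i < S.length, ((i + (S.length - 1)) % S.length + 1) % S.length = i := by
    intro i hi
    rw [Nat.mod_add_mod, show i + (S.length - 1) + 1 = i + S.length by omega,
      Nat.add_mod_right, Nat.mod_eq_of_lt hi]
  have unshift : ∀ i < S.length, ((i + 1) % S.length + (S.length - 1)) % S.length = i := by
    intro i hi
    rw [Nat.mod_add_mod, show i + 1 + (S.length - 1) = i + S.length by omega,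
      Nat.add_mod_right, Nat.mod_eq_of_lt hi]
  refine Finset.card_nbij' (fun i => (i + (S.length - 1)) % S.length)
    (fun i => (i + 1) % S.length) ?_ ?_ ?_ ?_
  · intro i hi
    simp only [Finset.coe_filter, Finset.mem_range, Set.mem_ofPred_eq] at hi ⊢
    obtain ⟨hi, hpre, hlast⟩ := hi
    rw [rot_getLast? S hi] at hlast
    rw [prefix_rot_iff S y hi.le hy] at hpre
    refine ⟨Nat.mod_lt _ (by omega), ?_⟩
    rw [occursCyclicallyAt_cons, Nat.mod_mod, ← occursCyclicallyAt_mod, shift i hi]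
    exact ⟨hlast, hpre⟩
  · intro i hi
    simp only [Finset.coe_filter, Finset.mem_range, Set.mem_ofPred_eq] at hi ⊢
    obtain ⟨hi, hocc⟩ := hi
    have hlt : (i + 1) % S.length < S.length := Nat.mod_lt _ (by omega)
    rw [occursCyclicallyAt_cons, Nat.mod_eq_of_lt hi] at hocc
    rw [prefix_rot_iff S y hlt.le hy, rot_getLast? S hlt, occursCyclicallyAt_mod, unshift i hi]
    exact ⟨hlt, hocc.2, hocc.1⟩
  · intro i hi
    exact shift i (Finset.mem_range.1 (Finset.mem_filter.1 hi).1)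
  · intro i hi
    exact unshift i (Finset.mem_range.1 (Finset.mem_filter.1 hi).1)

theorem isRotPrefix_iff_card_pos {β : Type*} (S y : List β) (hy : y.length ≤ S.length) :
    IsRotPrefix S y ↔
      0 < ((Finset.range S.length).filter fun i => OccursCyclicallyAt S y i).card := by
  simp only [Finset.card_pos, Finset.Nonempty, Finset.mem_filter, Finset.mem_range]
  exact exists_congr fun i => and_congr_right fun hi => prefix_rot_iff S y hi.le hy

/-- characterization of edge multiplicities in `G_k(S)` via rotations. -/
theorem edge_multiplicity_iff
    (S : List α) (dollar : α)
    (hn : 2 ≤ S.length)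
    (hlast : S.getLast? = some dollar)
    (hmin : ∀ c : α, c ≠ dollar → dollar < c)
    (honce : ∀ i, i < S.length - 1 → S.getD i dollar ≠ dollar)
    (k : ℕ) (hk1 : 1 ≤ k) (hk2 : k + 1 ≤ S.length)
    (x y : List α) (hx : IsKmer S k x) (hy : IsKmer S k y)
    (m : ℕ) (hm : 1 ≤ m)
    (c : α) (hc : x.head? = some c) :
    edgeMult S k x y = m ↔
      (x = c :: y.take (k - 1) ∧ IsRotPrefix S (c :: y) ∧
        m = (Finset.filter
              (fun i => y <+: rot S i ∧ (rot S i).getLast? = some c)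
              (Finset.range S.length)).card) := by
  obtain ⟨x, rfl⟩ : ∃ x', x = c :: x' := by
    cases x with
    | nil => simp at hc
    | cons a x => exact ⟨x, by simpa using hc⟩
  have hxk : x.length + 1 = k := hx.1
  obtain rfl : y.length = k := hy.1
  rw [edgeMult_cons S x y c (by omega) hxk, card_prefix_rot_getLast? S y c (by omega),
    isRotPrefix_iff_card_pos S (c :: y) hk2, List.cons_inj_right,
    show y.length - 1 = x.length by omega]
  split_ifs with h
  · constructor
    · rintro rfl
      exact ⟨h, hm, rfl⟩
    · exact fun hr => hr.2.2.symm
  · exact ⟨fun h0 => by omega, fun hr => absurd hr.1 h⟩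
end
end

section
/- If y is a prefix of some rotation of S with 1 ≤ |y| ≤ n and y has a unique Weiner link, then every string y' that is a prefix of some rotation of S and has y as a prefix also has a unique Weiner link. -/
noncomputable section
open scoped Classical

variable {α : Type*} [LinearOrder α]

/-- Every rotation of `S` is preceded by a rotation obtained by moving its last letter to the
front. -/
theorem exists_rot_eq_cons_take {β : Type*} (S : List β) {i : ℕ} (hi : i < S.length) :
    ∃ j < S.length, ∃ c, rot S j = c :: (rot S i).take (S.length - 1) := by
  rcases Nat.eq_zero_or_pos i with rfl | hpos
  · refine ⟨S.length - 1, by omega, S[S.length - 1], ?_⟩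
    unfold rot
    rw [List.drop_eq_getElem_cons (by omega : S.length - 1 < S.length),
      Nat.sub_add_cancel (by omega : 1 ≤ S.length)]
    simp
  · obtain ⟨k, rfl⟩ := Nat.exists_eq_succ_of_ne_zero hpos.ne'
    refine ⟨k, by omega, S[k], ?_⟩
    have h : S.length - 1 - (S.length - (k + 1)) = k := by omega
    unfold rot
    rw [List.drop_eq_getElem_cons (by omega : k < S.length), List.take_append,
      List.take_of_length_le (l := S.drop (k + 1)) (by simp; omega),
      List.length_drop, List.take_take, h, Nat.min_eq_left k.le_succ, List.cons_append]

theorem IsRotPrefix.exists_isWeinerLink {β : Type*} {S y : List β} (h : IsRotPrefix S y) :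
    ∃ c, IsWeinerLink S y c := by
  obtain ⟨i, hi, hy⟩ := h
  obtain ⟨j, hj, c, hc⟩ := exists_rot_eq_cons_take S hi
  exact ⟨c, j, hj, hc ▸ List.cons_prefix_cons.2 ⟨rfl, hy.take _⟩⟩

theorem IsWeinerLink.of_prefix {β : Type*} {S y y' : List β} {c : β} (h : IsWeinerLink S y' c)
    (hy : y <+: y') : IsWeinerLink S y c := by
  obtain ⟨i, hi, hp⟩ := h
  exact ⟨i, hi, (List.cons_prefix_cons.2 ⟨rfl, hy.take _⟩).trans hp⟩

/-- extensions of a string with a unique Weiner link have a unique Weiner link. -/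
theorem unique_weiner_link_extends
    (S : List α) (dollar : α)
    (hn : 2 ≤ S.length)
    (hlast : S.getLast? = some dollar)
    (hmin : ∀ c : α, c ≠ dollar → dollar < c)
    (honce : ∀ i, i < S.length - 1 → S.getD i dollar ≠ dollar)
    (y : List α) (hy1 : 1 ≤ y.length) (hy2 : y.length ≤ S.length)
    (hy3 : IsRotPrefix S y) (hu : HasUniqueWeinerLink S y) :
    ∀ y' : List α, IsRotPrefix S y' → y <+: y' → HasUniqueWeinerLink S y' := by
  intro y' hy' hpre
  obtain ⟨c, hc⟩ := hy'.exists_isWeinerLink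
  exact ⟨c, hc, fun d hd => hu.unique (hd.of_prefix hpre) (hc.of_prefix hpre)⟩
end
end

section
/- Let k ∈ [1,n−2], let z be a k-mer of S and y a (k+1)-mer of S with y[1..k] = z, and suppose that every rotation of S having z as a prefix also has y as a prefix. If z has a unique Weiner link, then w_{k+1}(y) = 1. -/
noncomputable section
open scoped Classical

variable {α : Type*} [LinearOrder α]

theorem rot_eq_rotate {β : Type*} (S : List β) {i : ℕ} (hi : i < S.length) : rot S i = S.rotate i :=
  (List.rotate_eq_drop_append_take hi.le).symm

/-- The next rotation is obtained by moving the first character to the end. -/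
theorem exists_rot_eq_cons_and_succ {β : Type*} (S : List β) {i : ℕ} (hi : i < S.length) :
    ∃ a t, rot S i = a :: t ∧ rot S ((i + 1) % S.length) = t ++ [a] := by
  have hpos : 0 < S.length := by omega
  rw [rot_eq_rotate S hi, rot_eq_rotate S (Nat.mod_lt _ hpos), List.rotate_mod,
    ← List.rotate_rotate]
  cases h : S.rotate i with
  | nil =>
    have := congrArg List.length h
    simp only [List.length_rotate, List.length_nil] at this
    omega
  | cons a t => exact ⟨a, t, rfl, by simp⟩

/-- If every rotation starting with `z` starts with `y`, a character preceding `z` in a rotation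
precedes `y` there too, as long as `c :: y` is no longer than the string. -/
theorem cons_prefix_rot_of_forall_prefix {β : Type*} (S z y : List β)
    (hlen : y.length + 1 ≤ S.length)
    (h : ∀ i < S.length, z <+: rot S i → y <+: rot S i) {c : β} {i : ℕ}
    (hi : i < S.length) (hc : (c :: z) <+: rot S i) : (c :: y) <+: rot S i := by
  obtain ⟨a, t, h1, h2⟩ := exists_rot_eq_cons_and_succ S hi
  have ht : t.length + 1 = S.length := by
    have := congrArg List.length h1
    rw [rot_eq_rotate S hi, List.length_rotate] at this
    simpa using this.symm
  rw [h1, List.cons_prefix_cons] at hc ⊢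
  refine ⟨hc.1, ?_⟩
  have hy := h _ (Nat.mod_lt _ (by omega)) (h2 ▸ hc.2.trans (List.prefix_append t [a]))
  rw [h2] at hy
  exact List.prefix_of_prefix_length_le hy (List.prefix_append t [a]) (by omega)

/-- an only child of a node with a unique Weiner link has weight 1. -/
theorem weight_of_only_child_unique_weiner_link
    (S : List α) (dollar : α)
    (hn : 2 ≤ S.length)
    (hlast : S.getLast? = some dollar)
    (hmin : ∀ c : α, c ≠ dollar → dollar < c)
    (honce : ∀ i, i < S.length - 1 → S.getD i dollar ≠ dollar)
    (k : ℕ) (hk1 : 1 ≤ k) (hk2 : k + 2 ≤ S.length)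
    (z y : List α) (hz : IsKmer S k z) (hy : IsKmer S (k + 1) y)
    (hzy : y.take k = z)
    (honlychild : ∀ i < S.length, z <+: rot S i → y <+: rot S i)
    (hu : HasUniqueWeinerLink S z) :
    wWeight S (k + 1) y = 1 := by
  have hylen : y.length = k + 1 := hy.1
  have hzlen : z.length = k := hz.1
  have hzpre : z <+: y := hzy ▸ List.take_prefix k y
  have hext : ∀ c, ∀ i < S.length, (c :: z) <+: rot S i → (c :: y) <+: rot S i :=
    fun c i hi => cons_prefix_rot_of_forall_prefix S z y (by omega) honlychild hi
  have hlink : ∀ d, IsWeinerLink S y d ↔ IsWeinerLink S z d := by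
    intro d
    unfold IsWeinerLink IsRotPrefix
    rw [List.take_of_length_le (by omega), List.take_of_length_le (by omega)]
    constructor
    · rintro ⟨i, hi, h⟩
      exact ⟨i, hi, (List.cons_prefix_cons.mpr ⟨rfl, hzpre⟩).trans h⟩
    · rintro ⟨i, hi, h⟩
      exact ⟨i, hi, hext d i hi h⟩
  obtain ⟨c, hc, huniq⟩ := hu
  refine if_pos ⟨c, fun d => ?_, ?_⟩
  · rw [hlink]
    exact ⟨huniq d, fun h => h ▸ hc⟩
  · rw [Nat.add_sub_cancel, hzy]
    exact hext c
end
end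

section
/- Let k ∈ [1,n−2], let z be a k-mer of S and y a (k+1)-mer of S with y[1..k] = z, and suppose that every rotation of S having z as a prefix also has y as a prefix. If z has at least two Weiner links, then w_{k+1}(y) = w_k(z), and this common value equals the number of rotations of S having z as a prefix. -/
noncomputable section
open scoped Classical

variable {α : Type*} [LinearOrder α]

theorem exists_rot_eq_append_singleton {S t : List α} {i : ℕ} {c : α} (hi : i < S.length)
    (h : rot S i = c :: t) : ∃ j < S.length, rot S j = t ++ [c] := by
  have hpos : 0 < S.length := by omega
  have hlt := Nat.mod_lt (i + 1) hpos
  refine ⟨(i + 1) % S.length, hlt, ?_⟩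
  rw [rot, ← List.rotate_eq_drop_append_take hi.le] at h
  rw [rot, ← List.rotate_eq_drop_append_take hlt.le, List.rotate_mod,
    ← List.rotate_rotate, h]
  simp

theorem IsWeinerLink.of_only_child {S z y : List α} {c : α}
    (hz : z.length + 1 ≤ S.length) (hy : y.length + 1 ≤ S.length)
    (hchild : ∀ i < S.length, z <+: rot S i → y <+: rot S i)
    (h : IsWeinerLink S z c) : IsWeinerLink S y c := by
  obtain ⟨i, hi, hpre⟩ := h
  refine ⟨i, hi, ?_⟩
  rw [List.take_of_length_le (by omega)] at hpre ⊢
  have hlen : (rot S i).length = S.length := by simp [rot]; omega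
  obtain ⟨u, hu⟩ := hpre
  rw [List.cons_append] at hu
  obtain ⟨j, hj, hrot⟩ := exists_rot_eq_append_singleton hi hu.symm
  have hyj := hchild j hj (by rw [hrot, List.append_assoc]; exact List.prefix_append _ _)
  rw [hrot] at hyj
  rw [← hu, List.length_cons] at hlen
  rw [← hu, List.cons_prefix_cons]
  exact ⟨rfl, List.prefix_of_prefix_length_le hyj (List.prefix_append _ _) (by omega)⟩

theorem wWeight_eq_rotCount_of_two_weiner_links {S y : List α} {c d : α} (k : ℕ) (hcd : c ≠ d)
    (hc : IsWeinerLink S y c) (hd : IsWeinerLink S y d) : wWeight S k y = rotCount S y := by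
  rw [wWeight, if_neg]
  rintro ⟨e, he, -⟩
  exact hcd (((he c).1 hc).trans ((he d).1 hd).symm)

theorem rotCount_eq_of_only_child {S z y : List α} (hzy : z <+: y)
    (hchild : ∀ i < S.length, z <+: rot S i → y <+: rot S i) :
    rotCount S y = rotCount S z := by
  rw [rotCount, rotCount]
  congr 1
  refine Finset.filter_congr fun i hi => ?_
  exact ⟨hzy.trans, hchild i (Finset.mem_range.1 hi)⟩

/-- an only child of a node with multiple Weiner links inherits
the weight of its parent, which equals the number of rotations with the parent
as a prefix. -/
theorem weight_of_only_child_multiple_weiner_links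
    (S : List α) (dollar : α)
    (hn : 2 ≤ S.length)
    (hlast : S.getLast? = some dollar)
    (hmin : ∀ c : α, c ≠ dollar → dollar < c)
    (honce : ∀ i, i < S.length - 1 → S.getD i dollar ≠ dollar)
    (k : ℕ) (hk1 : 1 ≤ k) (hk2 : k + 2 ≤ S.length)
    (z y : List α) (hz : IsKmer S k z) (hy : IsKmer S (k + 1) y)
    (hzy : y.take k = z)
    (honlychild : ∀ i < S.length, z <+: rot S i → y <+: rot S i)
    (hmulti : ∃ c d, c ≠ d ∧ IsWeinerLink S z c ∧ IsWeinerLink S z d) :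
    wWeight S (k + 1) y = wWeight S k z ∧ wWeight S k z = rotCount S z := by
  obtain ⟨c, d, hcd, hc, hd⟩ := hmulti
  have hzlen := hz.1
  have hylen := hy.1
  have hlink {e : α} (he : IsWeinerLink S z e) : IsWeinerLink S y e :=
    he.of_only_child (by omega) (by omega) honlychild
  have hwz := wWeight_eq_rotCount_of_two_weiner_links k hcd hc hd
  have hwy := wWeight_eq_rotCount_of_two_weiner_links (k + 1) hcd (hlink hc) (hlink hd)
  have hpre : z <+: y := hzy ▸ List.take_prefix k y
  exact ⟨by rw [hwy, hwz, rotCount_eq_of_only_child hpre honlychild], hwz⟩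
end
end
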